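/- Let N ≥ 2 and n ≥ 1 be integers, let α₁, …, α_n be integers each coprime to N, and let u₁, …, u_n be real numbers. Set ζ = exp(2πi/N). Then N · Σ_{q ∈ Q} Π_{j=1}^{n} b₁((u_j + q_j)/N) − Π_{j=1}^{n} b₁(u_j) = Σ_{k=1}^{N−1} Π_{j=1}^{n} ζ^{−α_j·k·⌊u_j⌋} / (ζ^{α_j·k} − 1), an equality of complex numbers (the left-hand side being real). -/

import Mathlib

/-- The periodic Bernoulli function `b_k(x) = B_k(x - ⌊x⌋)`. -/
noncomputable def periodicBernoulli (k : ℕ) (x : ℝ) : ℝ :=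
  Polynomial.aeval (Int.fract x) (Polynomial.bernoulli k)

theorem periodicBernoulli_one (x : ℝ) : periodicBernoulli 1 x = Int.fract x - 1 / 2 := by
  simp [periodicBernoulli, Polynomial.bernoulli_one]

theorem periodicBernoulli_add_one (k : ℕ) (x : ℝ) :
    periodicBernoulli k (x + 1) = periodicBernoulli k x := by
  simp [periodicBernoulli]

/-- The sum of a periodic function over a period does not depend on the starting point. -/
theorem Function.Periodic.sum_range_add {M : Type*} [AddCommGroup M] {N : ℕ} {f : ℤ → M}
    (hf : Function.Periodic f (N : ℤ)) (m : ℤ) :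
    ∑ q ∈ Finset.range N, f (q + m) = ∑ q ∈ Finset.range N, f q := by
  have step (m : ℤ) : ∑ q ∈ Finset.range N, f (q + (m + 1)) =
      ∑ q ∈ Finset.range N, f (q + m) := by
    have h := (Finset.sum_range_succ (fun q : ℕ => f (q + m)) N).symm.trans
      (Finset.sum_range_succ' (fun q : ℕ => f (q + m)) N)
    have hN : f (N + m) = f m := by rw [add_comm, hf]
    simp only [hN, Nat.cast_zero, zero_add, add_left_inj] at h
    rw [h]
    refine Finset.sum_congr rfl fun q _ => ?_
    congr 1
    push_cast
    ring
  induction m using Int.induction_on with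
  | zero => simp
  | succ i ih => rw [step, ih]
  | pred i ih => rw [← ih, ← step, sub_add_cancel]

theorem sum_range_natCast_mul_pow_mul_sub_one {R : Type*} [CommRing R] (ω : R) (N : ℕ) :
    (∑ q ∈ Finset.range N, (q : R) * ω ^ q) * (ω - 1) =
      N * ω ^ N - ∑ q ∈ Finset.range N, ω ^ (q + 1) := by
  induction N with
  | zero => simp
  | succ N ih =>
    rw [Finset.sum_range_succ, Finset.sum_range_succ, add_mul, ih]
    push_cast
    ring

/-- For an `N`-th root of unity `ω`, the twisted sum of `b₁((u + q) / N)` only involves the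
representatives `(fract u + q) / N`, which lie in `[0, 1)`. -/
theorem sum_zpow_mul_periodicBernoulli_one {N : ℕ} (hN : N ≠ 0) {ω : ℂ} (hω : ω ^ N = 1)
    (u : ℝ) :
    ∑ q ∈ Finset.range N, ω ^ q * (periodicBernoulli 1 ((u + q) / N) : ℂ) =
      ω ^ (-⌊u⌋) *
        ∑ q ∈ Finset.range N, ω ^ q * (((Int.fract u + q) / N - 1 / 2 : ℝ) : ℂ) := by
  have hω0 : ω ≠ 0 := by
    rintro rfl
    simp [hN] at hω
  have hNR : (0 : ℝ) < N := by positivity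
  have hper : Function.Periodic
      (fun q : ℤ => ω ^ q * (periodicBernoulli 1 ((u + q) / N) : ℂ)) (N : ℤ) := by
    intro q
    have h : (u + ((q + N : ℤ) : ℝ)) / N = (u + q) / N + 1 := by
      push_cast
      field_simp
      ring
    simp only [h, periodicBernoulli_add_one, zpow_add₀ hω0, zpow_natCast, hω, mul_one]
  have hshift := hper.sum_range_add (-⌊u⌋)
  simp only [zpow_natCast, Int.cast_natCast] at hshift
  rw [← hshift, Finset.mul_sum]
  refine Finset.sum_congr rfl fun q hq => ?_
  have harg : (u + ((q + -⌊u⌋ : ℤ) : ℝ)) / N = (Int.fract u + q) / N := by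
    rw [← Int.self_sub_floor]
    push_cast
    ring
  have hq1 : (q : ℝ) + 1 ≤ N := by exact_mod_cast Finset.mem_range.mp hq
  have hfract : Int.fract ((Int.fract u + q) / N) = (Int.fract u + q) / N := by
    rw [Int.fract_eq_self]
    refine ⟨div_nonneg (add_nonneg (Int.fract_nonneg u) q.cast_nonneg) hNR.le, ?_⟩
    rw [div_lt_one hNR]
    linarith [Int.fract_lt_one u]
  rw [harg, periodicBernoulli_one, hfract, zpow_add₀ hω0, zpow_natCast]
  ring

/-- The distribution relation for `b₁`. -/
theorem sum_periodicBernoulli_one {N : ℕ} (hN : N ≠ 0) (u : ℝ) :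
    ∑ q ∈ Finset.range N, (periodicBernoulli 1 ((u + q) / N) : ℂ) = periodicBernoulli 1 u := by
  have h := sum_zpow_mul_periodicBernoulli_one hN (one_pow N) u
  simp only [one_pow, one_mul, one_zpow] at h
  rw [h, periodicBernoulli_one, ← Complex.ofReal_sum, Complex.ofReal_inj]
  have hNR : (N : ℝ) ≠ 0 := by exact_mod_cast hN
  have hsum (M : ℕ) : ∑ q ∈ Finset.range M, (q : ℝ) = M * (M - 1) / 2 := by
    induction M with
    | zero => simp
    | succ M ih =>
      rw [Finset.sum_range_succ, ih]
      push_cast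
      ring
  rw [Finset.sum_sub_distrib, ← Finset.sum_div, Finset.sum_add_distrib, hsum]
  simp only [Finset.sum_const, Finset.card_range, nsmul_eq_mul]
  field_simp
  ring

theorem sum_pow_mul_periodicBernoulli_one {N : ℕ} (hN : N ≠ 0) {ω : ℂ} (hω : ω ^ N = 1)
    (hω1 : ω ≠ 1) (u : ℝ) :
    ∑ q ∈ Finset.range N, ω ^ q * (periodicBernoulli 1 ((u + q) / N) : ℂ) =
      ω ^ (-⌊u⌋) / (ω - 1) := by
  have hsub : ω - 1 ≠ 0 := sub_ne_zero.mpr hω1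
  have hNC : (N : ℂ) ≠ 0 := by exact_mod_cast hN
  have hgeom : ∑ q ∈ Finset.range N, ω ^ q = 0 := by
    rw [geom_sum_eq hω1, hω, sub_self, zero_div]
  have hlin : ∑ q ∈ Finset.range N, (q : ℂ) * ω ^ q = N / (ω - 1) := by
    rw [eq_div_iff hsub, sum_range_natCast_mul_pow_mul_sub_one, hω]
    simp only [pow_succ]
    rw [← Finset.sum_mul, hgeom]
    ring
  rw [sum_zpow_mul_periodicBernoulli_one hN hω, div_eq_mul_inv]
  congr 1
  calc ∑ q ∈ Finset.range N, ω ^ q * (((Int.fract u + q) / N - 1 / 2 : ℝ) : ℂ)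
      = ∑ q ∈ Finset.range N, ((((Int.fract u : ℝ) : ℂ) / N - 1 / 2) * ω ^ q
          + (N : ℂ)⁻¹ * (q * ω ^ q)) := by
        refine Finset.sum_congr rfl fun q _ => ?_
        push_cast
        ring
    _ = (ω - 1)⁻¹ := by
        rw [Finset.sum_add_distrib, ← Finset.mul_sum, ← Finset.mul_sum, hgeom, hlin]
        field_simp
        ring

theorem zpow_sum_eq_prod {ι K : Type*} [Field K] {a : K} (ha : a ≠ 0) (s : Finset ι)
    (f : ι → ℤ) : a ^ (∑ i ∈ s, f i) = ∏ i ∈ s, a ^ f i := by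
  classical
  induction s using Finset.induction_on with
  | empty => simp
  | insert i s hi ih => rw [Finset.sum_insert hi, Finset.prod_insert hi, zpow_add₀ ha, ih]

/-- Orthogonality of the powers of a primitive root of unity. -/
theorem IsPrimitiveRoot.sum_zpow_mul {K : Type*} [Field K] {ζ : K} {N : ℕ}
    (hζ : IsPrimitiveRoot ζ N) (m : ℤ) :
    ∑ k ∈ Finset.range N, ζ ^ (m * k) = if (N : ℤ) ∣ m then (N : K) else 0 := by
  simp only [zpow_mul, zpow_natCast]
  split_ifs with h
  · simp [(hζ.zpow_eq_one_iff_dvd m).mpr h]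
  · have h1 : ζ ^ m ≠ 1 := fun h' => h ((hζ.zpow_eq_one_iff_dvd m).mp h')
    rw [geom_sum_eq h1, ← zpow_natCast, ← zpow_mul, mul_comm, zpow_mul, zpow_natCast,
      hζ.pow_eq_one, one_zpow, sub_self, zero_div]

/-- Detecting the congruence with roots of unity makes the sum over tuples factor. -/
theorem IsPrimitiveRoot.natCast_mul_sum_filter_dvd_prod {K : Type*} [Field K] {ζ : K} {N n : ℕ}
    (hζ : IsPrimitiveRoot ζ N) (hN : N ≠ 0) (α : Fin n → ℤ) (f : Fin n → ℕ → K) :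
    (N : K) * ∑ q ∈ Finset.univ.filter
        (fun q : Fin n → Fin N => (N : ℤ) ∣ ∑ j, ((q j : ℕ) : ℤ) * α j), ∏ j, f j (q j) =
      ∑ k ∈ Finset.range N, ∏ j, ∑ q ∈ Finset.range N, (ζ ^ (α j * (k : ℤ))) ^ q * f j q := by
  have hprod (k : ℕ) : ∏ j, ∑ q ∈ Finset.range N, (ζ ^ (α j * (k : ℤ))) ^ q * f j q =
      ∑ q : Fin n → Fin N, ζ ^ ((∑ j, ((q j : ℕ) : ℤ) * α j) * k) * ∏ j, f j (q j) := by
    simp only [Finset.sum_range, Finset.prod_univ_sum, Fintype.piFinset_univ,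
      Finset.prod_mul_distrib]
    refine Finset.sum_congr rfl fun q _ => ?_
    congr 1
    rw [Finset.sum_mul, zpow_sum_eq_prod (hζ.ne_zero hN)]
    refine Finset.prod_congr rfl fun j _ => ?_
    rw [← zpow_natCast, ← zpow_mul]
    congr 1
    ring
  simp only [hprod]
  rw [Finset.sum_comm, Finset.sum_filter, Finset.mul_sum]
  refine Finset.sum_congr rfl fun q _ => ?_
  rw [← Finset.sum_mul, hζ.sum_zpow_mul]
  split_ifs <;> simp

/-- the smoothed Dedekind-type sum over
`Q = {q ∈ {0,…,N-1}^n : N ∣ ∑ q_j α_j}` equals a sum of products of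
cyclotomic expressions, where `ζ = exp(2πi/N)`. -/
theorem stmt2 (N n : ℕ) (hN : 2 ≤ N) (hn : 1 ≤ n)
    (α : Fin n → ℤ) (hα : ∀ j, IsCoprime (α j) (N : ℤ))
    (u : Fin n → ℝ) :
    (((N : ℝ) *
          ∑ q ∈ Finset.univ.filter
              (fun q : Fin n → Fin N => (N : ℤ) ∣ ∑ j, ((q j : ℕ) : ℤ) * α j),
            ∏ j, periodicBernoulli 1 ((u j + ((q j : ℕ) : ℝ)) / N)
        - ∏ j, periodicBernoulli 1 (u j) : ℝ) : ℂ)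
      = ∑ k ∈ Finset.Ico 1 N,
          ∏ j,
            Complex.exp (2 * Real.pi * Complex.I / N) ^ (-(α j * (k : ℤ) * ⌊u j⌋)) /
              (Complex.exp (2 * Real.pi * Complex.I / N) ^ (α j * (k : ℤ)) - 1) := by
  have hN0 : N ≠ 0 := by omega
  have hζ := Complex.isPrimitiveRoot_exp N hN0
  set ζ := Complex.exp (2 * Real.pi * Complex.I / N)
  push_cast
  rw [hζ.natCast_mul_sum_filter_dvd_prod hN0 α
      (fun j q => (periodicBernoulli 1 ((u j + (q : ℝ)) / N) : ℂ)),
    Finset.range_eq_Ico, Finset.sum_eq_sum_Ico_succ_bot (by omega), ← Finset.range_eq_Ico]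
  simp only [Nat.cast_zero, mul_zero, zpow_zero, one_pow, one_mul,
    sum_periodicBernoulli_one hN0, zero_add, add_sub_cancel_left]
  refine Finset.sum_congr rfl fun k hk => Finset.prod_congr rfl fun j _ => ?_
  obtain ⟨hk1, hkN⟩ := Finset.mem_Ico.mp hk
  have hpow : (ζ ^ (α j * (k : ℤ))) ^ N = 1 := by
    rw [← zpow_natCast, ← zpow_mul, hζ.zpow_eq_one_iff_dvd]
    exact dvd_mul_left _ _
  have hne : ζ ^ (α j * (k : ℤ)) ≠ 1 := by
    rw [Ne, hζ.zpow_eq_one_iff_dvd]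
    intro h
    have hdvd : N ∣ k := Int.natCast_dvd_natCast.mp ((hα j).symm.dvd_of_dvd_mul_left h)
    exact absurd (Nat.le_of_dvd hk1 hdvd) (by omega)
  rw [sum_pow_mul_periodicBernoulli_one hN0 hpow hne, ← zpow_mul, mul_neg]
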